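/- arXiv:1105.1475 — 2 statements merged into one kernel-verified Lean document; each statement's English description precedes it below -/
import Mathlib

section
/- (Lemma 5, relating sparsity and prediction norm.) Let β̂ be any square-root lasso minimizer, T̂ = {j : β̂ⱼ ≠ 0}, and m̂ = |T̂ \ T|. Then for any λ > 0, (λ/n)·√Q̂(β̂)·√|T̂| ≤ √|T̂|·‖Γ⁻¹S̃‖_∞·√Q̂(β₀) + √φ_max(m̂, Γ⁻¹E_n[x_ix_i']Γ⁻¹)·‖β̂ − β₀‖_{2,n}. -/
open Finset MeasureTheory ProbabilityTheory

namespace SqrtLasso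

/-- Empirical average `E_n[h_i] = n⁻¹ ∑ᵢ h i`. -/
noncomputable def En (n : ℕ) (h : Fin n → ℝ) : ℝ := (∑ i, h i) / n

/-- Euclidean inner product `a'b = ∑ⱼ aⱼ bⱼ`. -/
noncomputable def dot {p : ℕ} (a b : Fin p → ℝ) : ℝ := ∑ j, a j * b j

/-- Prediction norm `‖δ‖_{2,n} = (E_n[(x_i'δ)²])^{1/2}`. -/
noncomputable def predNorm (n : ℕ) {p : ℕ} (x : Fin n → Fin p → ℝ) (δ : Fin p → ℝ) : ℝ :=
  Real.sqrt (En n fun i => (dot (x i) δ) ^ 2)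

/-- `ℓ₁` norm of a vector. -/
noncomputable def l1 {p : ℕ} (v : Fin p → ℝ) : ℝ := ∑ j, |v j|

/-- Restriction `v_S`: equal to `v` on `S` and `0` outside. -/
def restr {p : ℕ} (S : Finset (Fin p)) (v : Fin p → ℝ) : Fin p → ℝ :=
  fun j => if j ∈ S then v j else 0

/-- `Γ v`, i.e. componentwise rescaling by loadings `γ`. -/
noncomputable def scl {p : ℕ} (γ v : Fin p → ℝ) : Fin p → ℝ := fun j => γ j * v j

/-- The support of a vector. -/
noncomputable def supp {p : ℕ} (β : Fin p → ℝ) : Finset (Fin p) := Finset.univ.filter fun j => β j ≠ 0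

/-- The least-squares criterion `Q̂(β) = E_n[(y_i - x_i'β)²]`. -/
noncomputable def Qhat (n : ℕ) {p : ℕ} (x : Fin n → Fin p → ℝ) (y : Fin n → ℝ)
    (β : Fin p → ℝ) : ℝ := En n fun i => (y i - dot (x i) β) ^ 2

/-- The restricted set `Δ_c̄`. -/
def Delta {p : ℕ} (γ : Fin p → ℝ) (T : Finset (Fin p)) (cb : ℝ) : Set (Fin p → ℝ) :=
  {δ | δ ≠ 0 ∧ l1 (scl γ (restr Tᶜ δ)) ≤ cb * l1 (scl γ (restr T δ))}

/-- The restricted eigenvalue `κ_c̄`. -/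
noncomputable def kappa (n : ℕ) {p : ℕ} (x : Fin n → Fin p → ℝ) (γ : Fin p → ℝ)
    (T : Finset (Fin p)) (cb : ℝ) : ℝ :=
  sInf {r | ∃ δ ∈ Delta γ T cb,
    r = Real.sqrt T.card * predNorm n x δ / l1 (scl γ (restr T δ))}

/-- The quantity `κ̃`. -/
noncomputable def kappaTilde (n : ℕ) {p : ℕ} (x : Fin n → Fin p → ℝ) (γ : Fin p → ℝ)
    (T : Finset (Fin p)) : ℝ :=
  sInf {r | ∃ δ : Fin p → ℝ, l1 (scl γ (restr Tᶜ δ)) < l1 (scl γ (restr T δ)) ∧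
    r = Real.sqrt T.card * predNorm n x δ /
      (l1 (scl γ (restr T δ)) - l1 (scl γ (restr Tᶜ δ)))}

/-- The score `S̃ = E_n[x_i(σε_i + r_i)] / √(E_n[(σε_i + r_i)²])`. -/
noncomputable def score (n : ℕ) {p : ℕ} (x : Fin n → Fin p → ℝ) (ε rr : Fin n → ℝ)
    (σ : ℝ) : Fin p → ℝ :=
  fun j => En n (fun i => x i j * (σ * ε i + rr i)) /
    Real.sqrt (En n fun i => (σ * ε i + rr i) ^ 2)

/-- `‖Γ⁻¹ S̃‖_∞ = max_j |S̃_j| / γ_j`. -/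
noncomputable def scoreSup (n : ℕ) {p : ℕ} (x : Fin n → Fin p → ℝ) (ε rr : Fin n → ℝ)
    (σ : ℝ) (γ : Fin p → ℝ) : ℝ :=
  ⨆ j, |score n x ε rr σ j| / γ j

/-- The quantity `ϱ_c̄`. -/
noncomputable def varrho (n : ℕ) {p : ℕ} (x : Fin n → Fin p → ℝ) (γ : Fin p → ℝ)
    (T : Finset (Fin p)) (β₀ : Fin p → ℝ) (S : Fin p → ℝ) (cb : ℝ) : ℝ :=
  sSup {r | ∃ δ ∈ Delta γ T cb, 0 < predNorm n x δ ∧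
    l1 (scl γ (δ + β₀)) ≤ cb * l1 (scl γ β₀) ∧ r = |dot S δ| / predNorm n x δ}

/-- Quadratic form `δ'Mδ`. -/
noncomputable def quadForm {p : ℕ} (M : Fin p → Fin p → ℝ) (δ : Fin p → ℝ) : ℝ :=
  ∑ j, ∑ k, δ j * M j k * δ k

/-- Maximal `m`-sparse eigenvalue `φ_max(m, M)`. -/
noncomputable def phiMax {p : ℕ} (M : Fin p → Fin p → ℝ) (T : Finset (Fin p)) (m : ℕ) : ℝ :=
  sSup {r | ∃ δ : Fin p → ℝ, δ ≠ 0 ∧ (supp δ \ T).card ≤ m ∧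
    r = quadForm M δ / ∑ j, (δ j) ^ 2}

/-- Minimal `m`-sparse eigenvalue `φ_min(m, M)`. -/
noncomputable def phiMin {p : ℕ} (M : Fin p → Fin p → ℝ) (T : Finset (Fin p)) (m : ℕ) : ℝ :=
  sInf {r | ∃ δ : Fin p → ℝ, δ ≠ 0 ∧ (supp δ \ T).card ≤ m ∧
    r = quadForm M δ / ∑ j, (δ j) ^ 2}

/-- Gram matrix `E_n[x_i x_i']`. -/
noncomputable def gram (n : ℕ) {p : ℕ} (x : Fin n → Fin p → ℝ) : Fin p → Fin p → ℝ :=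
  fun j k => En n fun i => x i j * x i k

/-- Rescaled Gram matrix `Γ⁻¹ E_n[x_i x_i'] Γ⁻¹`. -/
noncomputable def rgram (n : ℕ) {p : ℕ} (x : Fin n → Fin p → ℝ) (γ : Fin p → ℝ) :
    Fin p → Fin p → ℝ :=
  fun j k => gram n x j k / (γ j * γ k)


lemma En_nonneg' {n : ℕ} {h : Fin n → ℝ} (hh : ∀ i, 0 ≤ h i) : 0 ≤ En n h := by
  unfold En
  exact div_nonneg (Finset.sum_nonneg fun i _ => hh i) (Nat.cast_nonneg n)

lemma quad_bdd {p : ℕ} (M : Fin p → Fin p → ℝ) (T : Finset (Fin p)) (m : ℕ) :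
    BddAbove {r | ∃ δ : Fin p → ℝ, δ ≠ 0 ∧ (supp δ \ T).card ≤ m ∧
      r = quadForm M δ / ∑ j, (δ j) ^ 2} := by
  refine ⟨∑ j, ∑ k, |M j k|, ?_⟩
  rintro r ⟨δ, hδ, -, rfl⟩
  have hS : 0 ≤ ∑ j, (δ j) ^ 2 := Finset.sum_nonneg fun j _ => sq_nonneg _
  refine div_le_of_le_mul₀ hS (Finset.sum_nonneg fun j _ => Finset.sum_nonneg fun k _ => abs_nonneg _) ?_
  unfold quadForm
  rw [Finset.sum_mul]
  refine Finset.sum_le_sum fun j _ => ?_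
  rw [Finset.sum_mul]
  refine Finset.sum_le_sum fun k _ => ?_
  have h1 : (δ j) ^ 2 ≤ ∑ j, (δ j) ^ 2 :=
    Finset.single_le_sum (f := fun j => (δ j) ^ 2) (fun j _ => sq_nonneg _) (Finset.mem_univ j)
  have h2 : (δ k) ^ 2 ≤ ∑ j, (δ j) ^ 2 :=
    Finset.single_le_sum (f := fun j => (δ j) ^ 2) (fun j _ => sq_nonneg _) (Finset.mem_univ k)
  have h3 : |δ j * δ k| ≤ ∑ j, (δ j) ^ 2 := by
    rw [abs_le]
    constructor <;> nlinarith [sq_nonneg (δ j - δ k), sq_nonneg (δ j + δ k)]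
  calc δ j * M j k * δ k ≤ |δ j * M j k * δ k| := le_abs_self _
    _ = |M j k| * |δ j * δ k| := by rw [← abs_mul]; ring_nf
    _ ≤ _ := mul_le_mul_of_nonneg_left h3 (abs_nonneg _)

lemma quadForm_rgram (n p : ℕ) (x : Fin n → Fin p → ℝ) (γ w : Fin p → ℝ) :
    quadForm (rgram n x γ) w = En n fun i => (dot (x i) fun j => w j / γ j) ^ 2 := by
  unfold quadForm rgram gram En dot
  rw [Finset.sum_div]
  simp_rw [sq, Finset.sum_mul_sum, Finset.sum_div, Finset.mul_sum, Finset.sum_mul]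
  rw [Finset.sum_comm' (t' := Finset.univ) (s' := fun _ => Finset.univ) (by simp)]
  conv_lhs => enter [2, k]; rw [Finset.sum_comm]
  rw [Finset.sum_comm]
  refine Finset.sum_congr rfl fun i _ => ?_
  rw [Finset.sum_comm]
  refine Finset.sum_congr rfl fun j _ => Finset.sum_congr rfl fun k _ => ?_
  field_simp

lemma En_cs (n : ℕ) (a b : Fin n → ℝ) :
    -(En n fun i => a i * b i) ≤
      Real.sqrt (En n fun i => a i ^ 2) * Real.sqrt (En n fun i => b i ^ 2) := by
  have ha : 0 ≤ En n fun i => a i ^ 2 := En_nonneg' fun i => sq_nonneg _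
  rw [← Real.sqrt_mul ha]
  apply Real.le_sqrt_of_sq_le
  unfold En
  have := Finset.sum_mul_sq_le_sq_mul_sq Finset.univ a b
  rw [neg_sq, div_pow, div_mul_div_comm, ← sq]
  gcongr

/-- Small-step limit of the optimality inequality. -/
lemma limit_step (A B C t0 : ℝ) (ht0 : 0 < t0)
    (h : ∀ t, 0 < t → t ≤ t0 → C ≤ A + t * B) : C ≤ A := by
  by_contra! hlt
  have hB : 0 < |B| + 1 := by positivity
  have h1 := h (min t0 ((C - A) / 2 / (|B| + 1)))
    (lt_min ht0 (div_pos (by linarith) hB)) (min_le_left _ _)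
  set t := min t0 ((C - A) / 2 / (|B| + 1)) with ht
  have htp : 0 < t := lt_min ht0 (div_pos (by linarith) hB)
  have h2 : t ≤ (C - A) / 2 / (|B| + 1) := min_le_right _ _
  rw [le_div_iff₀ hB] at h2
  nlinarith [mul_le_mul_of_nonneg_left (le_abs_self B) htp.le]

/-- Lemma 5, relating sparsity and prediction norm. -/
theorem statement_9 (n p : ℕ) (hn : 1 ≤ n) (hp : 1 ≤ p)
    (x : Fin n → Fin p → ℝ) (β₀ γ : Fin p → ℝ) (hγ : ∀ j, 1 ≤ γ j)
    (hs : 1 ≤ (supp β₀).card)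
    (σ : ℝ) (hσ : 0 ≤ σ) (ε rr : Fin n → ℝ) (y : Fin n → ℝ)
    (hy : ∀ i, y i = dot (x i) β₀ + σ * ε i + rr i)
    (hQ : 0 < En n fun i => (σ * ε i + rr i) ^ 2)
    (lam : ℝ) (hlam : 0 < lam)
    (βh : Fin p → ℝ)
    (hmin : ∀ β : Fin p → ℝ,
      Real.sqrt (Qhat n x y βh) + lam / n * l1 (scl γ βh) ≤
        Real.sqrt (Qhat n x y β) + lam / n * l1 (scl γ β)) :
    lam / n * Real.sqrt (Qhat n x y βh) * Real.sqrt (supp βh).card ≤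
      Real.sqrt (supp βh).card * scoreSup n x ε rr σ γ * Real.sqrt (Qhat n x y β₀) +
        Real.sqrt (phiMax (rgram n x γ) (supp β₀) ((supp βh \ supp β₀).card)) *
          predNorm n x (βh - β₀) := by
  classical
  have hγ0 : ∀ j, 0 < γ j := fun j => lt_of_lt_of_le one_pos (hγ j)
  set K : ℝ := ((supp βh).card : ℝ) with hK
  have hK0 : 0 ≤ K := Nat.cast_nonneg _
  set w : Fin p → ℝ := fun j => SignType.sign (βh j) with hw
  set d : Fin p → ℝ := fun j => w j / γ j with hd
  set c : ℝ := lam / n with hc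
  have hc0 : 0 ≤ c := by positivity
  set u : Fin n → ℝ := fun i => σ * ε i + rr i with hu
  have hmem : ∀ j, j ∈ supp βh ↔ βh j ≠ 0 := by intro j; simp [supp]
  have hwabs : ∀ j, |w j| = if j ∈ supp βh then 1 else 0 := by
    intro j
    rw [hw]
    rcases lt_trichotomy (βh j) 0 with h | h | h
    · simp [hmem, h, h.ne]
    · simp [hmem, h]
    · simp [hmem, h, h.ne']
  have hwsq : ∑ j, w j ^ 2 = K := by
    have : ∀ j, w j ^ 2 = if j ∈ supp βh then 1 else 0 := by
      intro j
      rw [← sq_abs, hwabs]; split_ifs <;> simp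
    simp [this, hK]
  have hsum1 : ∑ j, (if j ∈ supp βh then (1 : ℝ) else 0) = K := by simp [hK]
  -- small step size
  obtain ⟨t0, ht0, ht0'⟩ : ∃ t0 : ℝ, 0 < t0 ∧ ∀ j ∈ supp βh, t0 ≤ |βh j| := by
    rcases (supp βh).eq_empty_or_nonempty with h | h
    · exact ⟨1, one_pos, by simp [h]⟩
    · obtain ⟨j, hj, hj'⟩ := Finset.exists_min_image (supp βh) (fun j => |βh j|) h
      exact ⟨|βh j|, abs_pos.2 ((hmem j).1 hj), hj'⟩
  have hl1 : ∀ t, 0 < t → t ≤ t0 →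
      l1 (scl γ fun j => βh j - t * d j) = l1 (scl γ βh) - t * K := by
    intro t htp ht
    unfold l1 scl
    rw [← hsum1, Finset.mul_sum, ← Finset.sum_sub_distrib]
    refine Finset.sum_congr rfl fun j _ => ?_
    have e : γ j * (βh j - t * d j) = γ j * βh j - t * w j := by
      have := (hγ0 j).ne'
      simp only [hd]; field_simp
    rw [e]
    by_cases hj : j ∈ supp βh
    · have h1 := ht0' j hj
      simp only [hj, if_true]
      have h2 : t ≤ γ j * |βh j| := by nlinarith [hγ j, abs_nonneg (βh j)]
      rcases lt_or_gt_of_ne ((hmem j).1 hj) with h | h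
      · have : w j = -1 := by simp [hw, h]
        rw [abs_of_neg h] at h2
        rw [this, abs_of_nonpos (by linarith), abs_of_nonpos (by nlinarith [hγ0 j])]; ring
      · have : w j = 1 := by simp [hw, h]
        rw [abs_of_pos h] at h2
        rw [this, abs_of_nonneg (by linarith), abs_of_nonneg (by nlinarith [hγ0 j])]
    · have : βh j = 0 := by by_contra h; exact hj ((hmem j).2 h)
      have hw0 : w j = 0 := by simp [hw, this]
      simp [this, hj, hw0]
  have hdot : ∀ i t, dot (x i) (fun j => βh j - t * d j) = dot (x i) βh - t * dot (x i) d := by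
    intro i t
    unfold dot
    rw [Finset.mul_sum, ← Finset.sum_sub_distrib]
    exact Finset.sum_congr rfl fun j _ => by ring
  set A : ℝ := En n fun i => (y i - dot (x i) βh) * dot (x i) d with hA
  set B : ℝ := En n fun i => (dot (x i) d) ^ 2 with hB
  have hQt : ∀ t, Qhat n x y (fun j => βh j - t * d j) = Qhat n x y βh + 2 * t * A + t ^ 2 * B := by
    intro t
    simp only [hA, hB, Qhat, En, hdot]
    rw [← mul_div_assoc, ← mul_div_assoc, ← add_div, ← add_div, Finset.mul_sum, Finset.mul_sum,
      ← Finset.sum_add_distrib, ← Finset.sum_add_distrib]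
    congr 1
    exact Finset.sum_congr rfl fun i _ => by ring
  have hQnn : ∀ β, 0 ≤ Qhat n x y β := fun β => En_nonneg' fun i => sq_nonneg _
  -- optimality
  have hopt : c * K * Real.sqrt (Qhat n x y βh) ≤ A := by
    refine limit_step A (B / 2) _ t0 ht0 fun t htp ht => ?_
    have h1 := hmin (fun j => βh j - t * d j)
    rw [hl1 t htp ht] at h1
    have h2 : Real.sqrt (Qhat n x y βh) + c * K * t ≤
        Real.sqrt (Qhat n x y (fun j => βh j - t * d j)) := by linarith
    have h3 : 0 ≤ c * K * t := by positivity
    have h4 := pow_le_pow_left₀ (by positivity) h2 2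
    rw [Real.sq_sqrt (hQnn _), hQt, add_sq, Real.sq_sqrt (hQnn _)] at h4
    have h5 : t * (2 * (c * K * Real.sqrt (Qhat n x y βh))) ≤ t * (2 * (A + t * (B / 2))) := by
      nlinarith [sq_nonneg (c * K * t)]
    have h6 := le_of_mul_le_mul_left h5 htp
    linarith
  -- decomposition
  have hdotsub : ∀ i, dot (x i) (βh - β₀) = dot (x i) βh - dot (x i) β₀ := by
    intro i
    simp only [dot, Pi.sub_apply, mul_sub, Finset.sum_sub_distrib]
  have hdec : A = (En n fun i => u i * dot (x i) d) +
      -(En n fun i => dot (x i) d * dot (x i) (βh - β₀)) := by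
    simp only [hA, En]
    rw [← sub_eq_add_neg, ← sub_div, ← Finset.sum_sub_distrib]
    congr 1
    refine Finset.sum_congr rfl fun i _ => ?_
    rw [hdotsub, hy]; simp only [hu]; ring
  have hQ0 : Qhat n x y β₀ = En n fun i => u i ^ 2 := by
    unfold Qhat
    congr 1
    funext i
    rw [hy]; simp only [hu]; ring
  have hq0 : 0 < Real.sqrt (Qhat n x y β₀) := by rw [hQ0]; exact Real.sqrt_pos.2 hQ
  have hsup : ∀ j, |score n x ε rr σ j| / γ j ≤ scoreSup n x ε rr σ γ := fun j =>
    le_ciSup (f := fun j => |score n x ε rr σ j| / γ j) (Set.finite_range _).bddAbove j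
  have hscore : ∀ j, En n (fun i => x i j * u i) =
      score n x ε rr σ j * Real.sqrt (Qhat n x y β₀) := by
    intro j
    have h0 := hq0.ne'
    rw [hQ0] at h0 ⊢
    unfold score
    rw [div_mul_cancel₀ _ h0]
  have hfirst : (En n fun i => u i * dot (x i) d) ≤
      K * scoreSup n x ε rr σ γ * Real.sqrt (Qhat n x y β₀) := by
    have e : (En n fun i => u i * dot (x i) d) = ∑ j, d j * En n (fun i => x i j * u i) := by
      unfold En dot
      simp_rw [Finset.mul_sum, mul_div_assoc', Finset.mul_sum]
      rw [Finset.sum_comm, Finset.sum_div]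
      exact Finset.sum_congr rfl fun j _ => by
        congr 1
        exact Finset.sum_congr rfl fun i _ => by ring
    rw [e, ← hsum1, Finset.sum_mul, Finset.sum_mul]
    refine Finset.sum_le_sum fun j _ => ?_
    rw [hscore, ← mul_assoc]
    refine mul_le_mul_of_nonneg_right ?_ hq0.le
    calc d j * score n x ε rr σ j ≤ |d j * score n x ε rr σ j| := le_abs_self _
      _ = |w j| * (|score n x ε rr σ j| / γ j) := by
        simp only [hd]
        rw [abs_mul, abs_div, abs_of_pos (hγ0 j)]; ring
      _ ≤ |w j| * scoreSup n x ε rr σ γ := mul_le_mul_of_nonneg_left (hsup j) (abs_nonneg _)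
      _ = _ := by rw [hwabs]
  have hsup0 : 0 ≤ scoreSup n x ε rr σ γ :=
    Real.iSup_nonneg fun j => div_nonneg (abs_nonneg _) (hγ0 j).le
  set φ : ℝ := phiMax (rgram n x γ) (supp β₀) ((supp βh \ supp β₀).card) with hφ
  rcases hK0.eq_or_lt with hKz | hKpos
  · rw [← hKz]
    simp only [Real.sqrt_zero, mul_zero, zero_mul, zero_add]
    exact mul_nonneg (Real.sqrt_nonneg _) (Real.sqrt_nonneg _)
  have hBφ : B ≤ φ * K := by
    rw [← div_le_iff₀ hKpos]
    refine le_csSup (quad_bdd _ _ _) ⟨w, ?_, ?_, ?_⟩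
    · intro h
      rw [h] at hwsq
      simp at hwsq
      linarith
    · have : supp w = supp βh := by
        ext j
        have h := hwabs j
        have e : j ∈ supp w ↔ |w j| ≠ 0 := by simp only [supp, Finset.mem_filter, Finset.mem_univ, true_and, ne_eq, abs_eq_zero]
        rw [e, h]
        split_ifs with hj <;> simp [hj]
      rw [this]
    · rw [hwsq, quadForm_rgram]
  have hsecond := En_cs n (fun i => dot (x i) d) (fun i => dot (x i) (βh - β₀))
  have hsB : Real.sqrt B ≤ Real.sqrt φ * Real.sqrt K := by
    rw [← Real.sqrt_mul' _ hK0]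
    exact Real.sqrt_le_sqrt hBφ
  have hpn : 0 ≤ predNorm n x (βh - β₀) := Real.sqrt_nonneg _
  have hsec : -(En n fun i => dot (x i) d * dot (x i) (βh - β₀)) ≤
      Real.sqrt φ * Real.sqrt K * predNorm n x (βh - β₀) :=
    hsecond.trans (mul_le_mul_of_nonneg_right hsB hpn)
  have hsK : 0 < Real.sqrt K := Real.sqrt_pos.2 hKpos
  have hKK : Real.sqrt K * Real.sqrt K = K := Real.mul_self_sqrt hK0
  refine le_of_mul_le_mul_left ?_ hsK
  calc Real.sqrt K * (c * Real.sqrt (Qhat n x y βh) * Real.sqrt K)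
      = c * (Real.sqrt K * Real.sqrt K) * Real.sqrt (Qhat n x y βh) := by ring
    _ = c * K * Real.sqrt (Qhat n x y βh) := by rw [hKK]
    _ ≤ K * scoreSup n x ε rr σ γ * Real.sqrt (Qhat n x y β₀) +
        Real.sqrt φ * Real.sqrt K * predNorm n x (βh - β₀) := by linarith
    _ = (Real.sqrt K * Real.sqrt K) * scoreSup n x ε rr σ γ * Real.sqrt (Qhat n x y β₀) +
        Real.sqrt φ * Real.sqrt K * predNorm n x (βh - β₀) := by rw [hKK]
    _ = _ := by ring
end SqrtLasso
end

section
/- (Theorem 5, lower bound on the prediction norm.) Let c > 1 and c̄ = (c+1)/(c−1), let β̂ be any square-root lasso minimizer, T̂ = {j : β̂ⱼ ≠ 0}, and m̂ = |T̂ \ T|. Suppose λ/n ≥ c‖Γ⁻¹S̃‖_∞, κ̃ > 0, ρ̄ := λ√s/(nκ̃) < 1, and φ_max(m̂, Γ⁻¹E_n[x_ix_i']Γ⁻¹) > 0. Then ‖β̂ − β₀‖_{2,n} ≥ (λ√|T̂|·√Q̂(β₀)) / (n·√φ_max(m̂, Γ⁻¹E_n[x_ix_i']Γ⁻¹)) ·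 (1 − 1/c − 2ϱ_c̄(ϱ_c̄ + ρ̄)/(1 − ρ̄²)). -/
open Finset MeasureTheory ProbabilityTheory

namespace SqrtLasso

set_option maxHeartbeats 2000000

lemma En_sq_nonneg (n : ℕ) (f : Fin n → ℝ) : 0 ≤ En n fun i => f i ^ 2 := by
  unfold En; positivity

lemma En_cs_s10 (n : ℕ) (f g : Fin n → ℝ) :
    |En n fun i => f i * g i| ≤ Real.sqrt (En n fun i => f i ^ 2) *
      Real.sqrt (En n fun i => g i ^ 2) := by
  rw [← Real.sqrt_mul (En_sq_nonneg n f)]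
  apply Real.abs_le_sqrt
  unfold En
  rw [div_pow, div_mul_div_comm, ← sq]
  gcongr
  exact Finset.sum_mul_sq_le_sq_mul_sq _ _ _

lemma En_add (n : ℕ) (f g : Fin n → ℝ) :
    (En n fun i => f i + g i) = En n f + En n g := by
  unfold En; rw [Finset.sum_add_distrib, add_div]

lemma En_sub (n : ℕ) (f g : Fin n → ℝ) :
    (En n fun i => f i - g i) = En n f - En n g := by
  unfold En; rw [Finset.sum_sub_distrib, sub_div]

lemma En_smul (n : ℕ) (a : ℝ) (f : Fin n → ℝ) :
    (En n fun i => a * f i) = a * En n f := by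
  unfold En; rw [← Finset.mul_sum, mul_div_assoc]

lemma En_sum (n : ℕ) {p : ℕ} (f : Fin p → Fin n → ℝ) :
    (En n fun i => ∑ j, f j i) = ∑ j, En n (f j) := by
  unfold En; rw [Finset.sum_comm, Finset.sum_div]

lemma dot_sub {p : ℕ} (a b d : Fin p → ℝ) : dot a (b - d) = dot a b - dot a d := by
  unfold dot; simp [mul_sub]

/-- linear functional given by averages -/
lemma En_dot (n : ℕ) {p : ℕ} (x : Fin n → Fin p → ℝ) (v : Fin p → ℝ) (g : Fin n → ℝ) :
    (En n fun i => dot (x i) v * g i) = ∑ j, v j * En n fun i => x i j * g i := by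
  simp_rw [← En_smul]
  rw [← En_sum]
  congr 1; funext i
  unfold dot; rw [Finset.sum_mul]
  exact Finset.sum_congr rfl fun j _ => by ring

lemma En_dot_sq (n : ℕ) {p : ℕ} (x : Fin n → Fin p → ℝ) (γ a : Fin p → ℝ) :
    (En n fun i => (dot (x i) fun j => a j / γ j) ^ 2) = quadForm (rgram n x γ) a := by
  simp_rw [sq]
  rw [En_dot]
  unfold quadForm rgram gram
  refine Finset.sum_congr rfl fun j _ => ?_
  have : (En n fun i => x i j * dot (x i) fun j => a j / γ j)
      = En n fun i => dot (x i) (fun j => a j / γ j) * x i j := by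
    congr 1; funext i; ring
  rw [this, En_dot, Finset.mul_sum]
  refine Finset.sum_congr rfl fun k _ => ?_
  have : (En n fun i => x i k * x i j) = En n fun i => x i j * x i k := by
    congr 1; funext i; ring
  rw [this]
  simp only [div_eq_mul_inv, mul_inv]
  ring

lemma predNorm_nonneg (n : ℕ) {p : ℕ} (x : Fin n → Fin p → ℝ) (δ : Fin p → ℝ) :
    0 ≤ predNorm n x δ := Real.sqrt_nonneg _

lemma l1_nonneg {p : ℕ} (v : Fin p → ℝ) : 0 ≤ l1 v := Finset.sum_nonneg fun _ _ => abs_nonneg _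

/-- score applied to a direction -/
lemma score_dot (n : ℕ) {p : ℕ} (x : Fin n → Fin p → ℝ) (ε rr : Fin n → ℝ) (σ : ℝ)
    (δ : Fin p → ℝ) :
    dot (score n x ε rr σ) δ = (En n fun i => dot (x i) δ * (σ * ε i + rr i)) /
      Real.sqrt (En n fun i => (σ * ε i + rr i) ^ 2) := by
  rw [En_dot, Finset.sum_div]
  unfold dot score
  exact Finset.sum_congr rfl fun j _ => by ring

lemma score_dot_le (n : ℕ) {p : ℕ} (x : Fin n → Fin p → ℝ) (ε rr : Fin n → ℝ) (σ : ℝ)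
    (δ : Fin p → ℝ) (hQ : 0 < En n fun i => (σ * ε i + rr i) ^ 2) :
    |dot (score n x ε rr σ) δ| ≤ predNorm n x δ := by
  have h := En_cs_s10 n (fun i => dot (x i) δ) (fun i => σ * ε i + rr i)
  have hq := Real.sqrt_pos.2 hQ
  rw [score_dot, abs_div, abs_of_pos hq, div_le_iff₀ hq]
  exact h

lemma score_le (n : ℕ) {p : ℕ} (x : Fin n → Fin p → ℝ) (ε rr : Fin n → ℝ) (σ : ℝ)
    (γ : Fin p → ℝ) (hγ : ∀ j, 1 ≤ γ j) (j : Fin p) :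
    |score n x ε rr σ j| ≤ scoreSup n x ε rr σ γ * γ j := by
  have : 0 < γ j := lt_of_lt_of_le one_pos (hγ j)
  rw [← div_le_iff₀ this]
  exact le_ciSup (f := fun j => |score n x ε rr σ j| / γ j) (Set.finite_range _).bddAbove j

lemma score_dot_l1 (n : ℕ) {p : ℕ} (x : Fin n → Fin p → ℝ) (ε rr : Fin n → ℝ) (σ : ℝ)
    (γ : Fin p → ℝ) (hγ : ∀ j, 1 ≤ γ j) (δ : Fin p → ℝ) :
    |dot (score n x ε rr σ) δ| ≤ scoreSup n x ε rr σ γ * l1 (scl γ δ) := by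
  unfold dot l1 scl
  rw [Finset.mul_sum]
  refine (Finset.abs_sum_le_sum_abs _ _).trans (Finset.sum_le_sum fun j _ => ?_)
  have : 0 < γ j := lt_of_lt_of_le one_pos (hγ j)
  rw [abs_mul, abs_mul, abs_of_pos this, ← mul_assoc]
  exact mul_le_mul_of_nonneg_right (score_le n x ε rr σ γ hγ j) (abs_nonneg _)

lemma l1_split {p : ℕ} (γ δ : Fin p → ℝ) (T : Finset (Fin p)) :
    l1 (scl γ δ) = l1 (scl γ (restr T δ)) + l1 (scl γ (restr Tᶜ δ)) := by
  unfold l1 scl restr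
  rw [← Finset.sum_add_distrib]
  refine Finset.sum_congr rfl fun j _ => ?_
  by_cases h : j ∈ T <;> simp [h]

lemma l1_diff {p : ℕ} (γ β β₀ : Fin p → ℝ) :
    l1 (scl γ β₀) - l1 (scl γ β) ≤
      l1 (scl γ (restr (supp β₀) (β - β₀))) - l1 (scl γ (restr (supp β₀)ᶜ (β - β₀))) := by
  unfold l1 scl restr
  rw [← Finset.sum_sub_distrib, ← Finset.sum_sub_distrib]
  refine Finset.sum_le_sum fun j _ => ?_
  by_cases h : β₀ j = 0
  · simp [supp, h]
  · simp only [supp, Finset.mem_filter, Finset.mem_univ, true_and, ne_eq, h, not_false_eq_true,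
      if_true, Finset.mem_compl, not_true_eq_false, if_false, mul_zero, abs_zero, sub_zero,
      Pi.sub_apply]
    have := abs_sub_abs_le_abs_sub (γ j * β₀ j) (γ j * β j)
    rwa [abs_sub_comm, ← mul_sub] at this

lemma l1_tri {p : ℕ} (γ β β₀ : Fin p → ℝ) :
    l1 (scl γ (β - β₀)) ≤ l1 (scl γ β) + l1 (scl γ β₀) := by
  unfold l1 scl
  rw [← Finset.sum_add_distrib]
  refine Finset.sum_le_sum fun j _ => ?_
  simp only [Pi.sub_apply, mul_sub]
  exact abs_sub _ _

/-- restricted eigenvalue inequality -/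
lemma kappa_ineq (n : ℕ) {p : ℕ} (x : Fin n → Fin p → ℝ) (γ : Fin p → ℝ)
    (T : Finset (Fin p)) (hκ : 0 < kappaTilde n x γ T) (δ : Fin p → ℝ) :
    l1 (scl γ (restr T δ)) - l1 (scl γ (restr Tᶜ δ)) ≤
      Real.sqrt T.card / kappaTilde n x γ T * predNorm n x δ := by
  have hN := predNorm_nonneg n x δ
  by_cases h : l1 (scl γ (restr Tᶜ δ)) < l1 (scl γ (restr T δ))
  · have hpos := sub_pos.2 h
    have : kappaTilde n x γ T ≤ Real.sqrt T.card * predNorm n x δ /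
      (l1 (scl γ (restr T δ)) - l1 (scl γ (restr Tᶜ δ))) := by
      apply csInf_le
      · refine ⟨0, ?_⟩
        rintro r ⟨d, hd, rfl⟩
        have := sub_pos.2 hd
        have := predNorm_nonneg n x d
        positivity
      · exact ⟨δ, h, rfl⟩
    rw [le_div_iff₀ hpos] at this
    rw [div_mul_eq_mul_div, le_div_iff₀ hκ]
    linarith
  · have : 0 ≤ Real.sqrt T.card / kappaTilde n x γ T * predNorm n x δ := by positivity
    linarith

lemma varrho_bdd (n : ℕ) {p : ℕ} (x : Fin n → Fin p → ℝ) (γ : Fin p → ℝ)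
    (T : Finset (Fin p)) (β₀ : Fin p → ℝ) (S : Fin p → ℝ) (cb : ℝ)
    (hS : ∀ δ, |dot S δ| ≤ predNorm n x δ) (δ : Fin p → ℝ)
    (h1 : l1 (scl γ (restr Tᶜ δ)) ≤ cb * l1 (scl γ (restr T δ)))
    (h2 : l1 (scl γ (δ + β₀)) ≤ cb * l1 (scl γ β₀)) :
    |dot S δ| ≤ varrho n x γ T β₀ S cb * predNorm n x δ := by
  rcases (predNorm_nonneg n x δ).eq_or_lt with h | h
  · have := hS δ
    rw [← h] at this ⊢
    simpa using this
  · rw [← div_le_iff₀ h]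
    apply le_csSup
    · refine ⟨1, ?_⟩
      rintro r ⟨d, -, hd, -, rfl⟩
      rw [div_le_one hd]; exact hS d
    · refine ⟨δ, ⟨?_, h1⟩, h, h2, rfl⟩
      rintro rfl
      simp [predNorm, dot, En] at h

lemma varrho_nonneg (n : ℕ) {p : ℕ} (x : Fin n → Fin p → ℝ) (γ : Fin p → ℝ)
    (T : Finset (Fin p)) (β₀ : Fin p → ℝ) (S : Fin p → ℝ) (cb : ℝ) :
    0 ≤ varrho n x γ T β₀ S cb := by
  apply Real.sSup_nonneg
  rintro r ⟨d, -, hd, -, rfl⟩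
  positivity

lemma phi_ineq {p : ℕ} (M : Fin p → Fin p → ℝ) (T : Finset (Fin p)) (m : ℕ)
    (hφ : 0 < phiMax M T m) (a : Fin p → ℝ) (ha : (supp a \ T).card ≤ m) :
    quadForm M a ≤ phiMax M T m * ∑ j, a j ^ 2 := by
  by_cases h : a = 0
  · subst h; simp [quadForm]
  · have hpos : 0 < ∑ j, a j ^ 2 := by
      obtain ⟨j, hj⟩ := Function.ne_iff.1 h
      exact Finset.sum_pos' (fun _ _ => sq_nonneg _) ⟨j, Finset.mem_univ _, by
        have : a j ≠ 0 := hj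
        positivity⟩
    rw [← div_le_iff₀ hpos]
    apply le_csSup
    · by_contra hb
      unfold phiMax at hφ
      rw [Real.sSup_of_not_bddAbove hb] at hφ
      exact lt_irrefl _ hφ
    · exact ⟨a, h, ha, rfl⟩

/-- one-dimensional stationarity -/
lemma kkt1 (A B C k g b : ℝ) (hA : 0 < A) (hb : b ≠ 0) (hk : 0 ≤ k) (hg : 0 ≤ g)
    (h : ∀ t : ℝ, Real.sqrt A + k * (g * |b|) ≤
      Real.sqrt (A - 2 * B * t + C * t ^ 2) + k * (g * |b + t|)) :
    Real.sqrt A * k * g ≤ |B| := by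
  have hq := Real.sqrt_pos.2 hA
  have hin : HasDerivAt (fun t : ℝ => A - 2 * B * t + C * t ^ 2) (-2 * B) 0 := by
    have h1 := ((hasDerivAt_id (0 : ℝ)).const_mul (2 * B)).const_sub A
    have h2 := ((hasDerivAt_pow 2 (0 : ℝ))).const_mul C
    exact (h1.add h2).congr_deriv (by simp)
  have hsq := hin.sqrt (by simpa using hA.ne')
  have habs : HasDerivAt (fun t : ℝ => |b + t|) (SignType.sign b : ℝ) 0 := by
    have h0 : HasDerivAt (fun t : ℝ => |t|) (SignType.sign b : ℝ) (b + 0) := by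
      simpa using hasDerivAt_abs hb
    exact h0.comp_const_add b 0
  have htot := hsq.add ((habs.const_mul g).const_mul k)
  have hm : IsLocalMin ((fun t : ℝ => Real.sqrt (A - 2 * B * t + C * t ^ 2)) +
      fun t : ℝ => k * (g * |b + t|)) 0 := by
    refine Filter.Eventually.of_forall fun t => ?_
    simpa using h t
  have h0 := hm.hasDerivAt_eq_zero htot
  have h0' : B = Real.sqrt A * (k * (g * (SignType.sign b : ℝ))) := by
    have e0 : A - 2 * B * 0 + C * 0 ^ 2 = A := by ring
    rw [e0] at h0
    have e1 : -2 * B / (2 * Real.sqrt A) = -(B / Real.sqrt A) := by field_simp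
    rw [e1] at h0
    have e2 : B / Real.sqrt A = k * (g * (SignType.sign b : ℝ)) := by linarith
    rw [div_eq_iff hq.ne'] at e2
    linarith
  rw [h0', abs_mul, abs_mul, abs_mul, abs_of_pos hq, abs_of_nonneg hk, abs_of_nonneg hg]
  have : |(SignType.sign b : ℝ)| = 1 := by
    rcases lt_or_gt_of_ne hb with hb | hb
    · simp [sign_neg hb]
    · simp [sign_pos hb]
  rw [this]; apply le_of_eq; ring

lemma kkt (n : ℕ) {p : ℕ} (x : Fin n → Fin p → ℝ) (y : Fin n → ℝ) (γ βh : Fin p → ℝ)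
    (hγ : ∀ j, 1 ≤ γ j) (k : ℝ) (hk : 0 ≤ k)
    (hmin : ∀ β : Fin p → ℝ,
      Real.sqrt (Qhat n x y βh) + k * l1 (scl γ βh) ≤
        Real.sqrt (Qhat n x y β) + k * l1 (scl γ β)) (j : Fin p) (hj : βh j ≠ 0) :
    Real.sqrt (Qhat n x y βh) * k * γ j ≤
      |En n fun i => x i j * (y i - dot (x i) βh)| := by
  have hg : 0 ≤ γ j := zero_le_one.trans (hγ j)
  have hA : 0 ≤ Qhat n x y βh := En_sq_nonneg _ _
  rcases hA.eq_or_lt with hA | hA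
  · rw [← hA]; simp
  apply kkt1 _ _ (En n fun i => x i j ^ 2) k (γ j) (βh j) hA hj hk hg
  intro t
  have h := hmin (βh + Pi.single j t)
  have h1 : Qhat n x y (βh + Pi.single j t) = Qhat n x y βh -
      2 * (En n fun i => x i j * (y i - dot (x i) βh)) * t + (En n fun i => x i j ^ 2) * t ^ 2 := by
    have e : ∀ i, dot (x i) (βh + Pi.single j t) = dot (x i) βh + x i j * t := by
      intro i
      simp [dot, mul_add, Finset.sum_add_distrib, Pi.single_apply]
    have e2 : Qhat n x y (βh + Pi.single j t) = En n (fun i => ((y i - dot (x i) βh) ^ 2 -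
        (2 * t) * (x i j * (y i - dot (x i) βh))) + t ^ 2 * x i j ^ 2) := by
      unfold Qhat
      congr 1; funext i; rw [e]; ring
    rw [e2, En_add, En_sub, En_smul, En_smul]
    unfold Qhat; ring
  have h2 : l1 (scl γ (βh + Pi.single j t)) - l1 (scl γ βh) = γ j * |βh j + t| - γ j * |βh j| := by
    unfold l1 scl
    rw [← Finset.sum_sub_distrib, Finset.sum_eq_single j]
    · simp [abs_mul, abs_of_nonneg hg]
    · intro i _ hi
      simp [hi]
    · simp
  rw [← h1]
  have h3 : l1 (scl γ (βh + Pi.single j t)) = l1 (scl γ βh) + (γ j * |βh j + t| - γ j * |βh j|) := by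
    linarith
  rw [h3] at h
  linarith

/-- sparse-eigenvalue bound -/
lemma sparse_bound (n : ℕ) {p : ℕ} (x : Fin n → Fin p → ℝ) (γ δ : Fin p → ℝ)
    (T U : Finset (Fin p)) (hφ : 0 < phiMax (rgram n x γ) T (U \ T).card) (w : ℝ) (hw : 0 ≤ w)
    (h : ∀ j ∈ U, w ≤ |(En n fun i => x i j * dot (x i) δ) / γ j|) :
    w * Real.sqrt U.card ≤
      Real.sqrt (phiMax (rgram n x γ) T (U \ T).card) * predNorm n x δ := by
  set D : Fin p → ℝ := fun j => (En n fun i => x i j * dot (x i) δ) / γ j with hD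
  set a : Fin p → ℝ := restr U D with ha
  set φ := phiMax (rgram n x γ) T (U \ T).card with hφd
  have hN := predNorm_nonneg n x δ
  have hsub : supp a ⊆ U := by
    intro j hj
    by_contra hc
    simp [supp, ha, restr, hc] at hj
  have h1 := phi_ineq (rgram n x γ) T (U \ T).card hφ a
    (Finset.card_le_card (Finset.sdiff_subset_sdiff hsub le_rfl))
  rw [← hφd] at h1
  set s := ∑ j, a j ^ 2 with hs
  have hs0 : 0 ≤ s := Finset.sum_nonneg fun _ _ => sq_nonneg _
  have h2 : s = En n fun i => (dot (x i) fun j => a j / γ j) * dot (x i) δ := by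
    rw [En_dot, hs]
    refine Finset.sum_congr rfl fun j _ => ?_
    by_cases hj : j ∈ U
    · simp only [ha, restr, hj, if_true, hD]; ring
    · simp [ha, restr, hj]
  have h3 := (le_abs_self _).trans (En_cs_s10 n (fun i => dot (x i) fun j => a j / γ j)
    (fun i => dot (x i) δ))
  rw [← h2, En_dot_sq] at h3
  have h4 : s ≤ Real.sqrt φ * Real.sqrt s * predNorm n x δ := by
    rw [← Real.sqrt_mul hφ.le]
    exact h3.trans (mul_le_mul_of_nonneg_right (Real.sqrt_le_sqrt h1) hN)
  have h5 : Real.sqrt s ≤ Real.sqrt φ * predNorm n x δ := by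
    rcases hs0.eq_or_lt with h0 | h0
    · rw [← h0]; simp; positivity
    · have hp := Real.sqrt_pos.2 h0
      have := Real.mul_self_sqrt hs0
      refine le_of_mul_le_mul_left ?_ hp
      rw [this]; linarith
  refine le_trans ?_ h5
  apply Real.le_sqrt_of_sq_le
  rw [mul_pow, Real.sq_sqrt (Nat.cast_nonneg _)]
  have h6 : ∑ j ∈ U, w ^ 2 ≤ ∑ j ∈ U, a j ^ 2 := by
    refine Finset.sum_le_sum fun j hj => ?_
    have : a j = D j := by simp [ha, restr, hj]
    rw [this, ← sq_abs (D j)]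
    exact pow_le_pow_left₀ hw (h j hj) 2
  have h7 : ∑ j ∈ U, a j ^ 2 ≤ s :=
    Finset.sum_le_sum_of_subset_of_nonneg (Finset.subset_univ _) fun _ _ _ => sq_nonneg _
  simp at h6
  linarith

/-- Theorem 5, lower bound on the prediction norm. -/
theorem statement_10 (n p : ℕ) (hn : 1 ≤ n) (hp : 1 ≤ p)
    (x : Fin n → Fin p → ℝ) (β₀ γ : Fin p → ℝ) (hγ : ∀ j, 1 ≤ γ j)
    (hs : 1 ≤ (supp β₀).card)
    (σ : ℝ) (hσ : 0 ≤ σ) (ε rr : Fin n → ℝ) (y : Fin n → ℝ)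
    (hy : ∀ i, y i = dot (x i) β₀ + σ * ε i + rr i)
    (hQ : 0 < En n fun i => (σ * ε i + rr i) ^ 2)
    (lam : ℝ) (hlam : 0 < lam)
    (c : ℝ) (hc : 1 < c)
    (hdom : c * scoreSup n x ε rr σ γ ≤ lam / n)
    (βh : Fin p → ℝ)
    (hmin : ∀ β : Fin p → ℝ,
      Real.sqrt (Qhat n x y βh) + lam / n * l1 (scl γ βh) ≤
        Real.sqrt (Qhat n x y β) + lam / n * l1 (scl γ β))
    (hκ : 0 < kappaTilde n x γ (supp β₀))
    (ρ : ℝ)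
    (hρdef : ρ = lam * Real.sqrt (supp β₀).card / (n * kappaTilde n x γ (supp β₀)))
    (hρ : ρ < 1)
    (hφ : 0 < phiMax (rgram n x γ) (supp β₀) ((supp βh \ supp β₀).card)) :
    lam * Real.sqrt (supp βh).card * Real.sqrt (Qhat n x y β₀) /
        (n * Real.sqrt (phiMax (rgram n x γ) (supp β₀) ((supp βh \ supp β₀).card))) *
        (1 - 1 / c -
          2 * varrho n x γ (supp β₀) β₀ (score n x ε rr σ) ((c + 1) / (c - 1)) *
            (varrho n x γ (supp β₀) β₀ (score n x ε rr σ) ((c + 1) / (c - 1)) + ρ) /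
            (1 - ρ ^ 2)) ≤
      predNorm n x (βh - β₀) := by
  set T := supp β₀ with hT
  set δ := βh - β₀ with hδ
  set S := score n x ε rr σ with hS
  set cb := (c + 1) / (c - 1) with hcb
  set R := varrho n x γ T β₀ S cb with hR
  set φ := phiMax (rgram n x γ) T (supp βh \ T).card with hφd
  set N := predNorm n x δ with hN
  have hn0 : (0 : ℝ) < n := by exact_mod_cast hn
  have hc1 : 0 < c - 1 := by linarith
  have hc0 : 0 < c := by linarith
  set k := lam / n with hk
  have hk0 : 0 < k := div_pos hlam hn0
  have hN0 : 0 ≤ N := predNorm_nonneg n x δ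
  have hR0 : 0 ≤ R := varrho_nonneg _ _ _ _ _ _ _
  have hsup : scoreSup n x ε rr σ γ ≤ k / c := by
    rw [le_div_iff₀ hc0]; linarith
  have hres : ∀ i, y i - dot (x i) β₀ = σ * ε i + rr i := fun i => by rw [hy]; ring
  have hresh : ∀ i, y i - dot (x i) βh = (σ * ε i + rr i) - dot (x i) δ := fun i => by
    rw [hδ, dot_sub, hy]; ring
  have hQ0 : Qhat n x y β₀ = En n fun i => (σ * ε i + rr i) ^ 2 := by
    unfold Qhat; simp_rw [hres]
  have hQh0 : 0 ≤ Qhat n x y βh := En_sq_nonneg _ _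
  set q := Real.sqrt (Qhat n x y β₀) with hq
  set qh := Real.sqrt (Qhat n x y βh) with hqh
  have hq0 : 0 < q := by rw [hq, hQ0]; exact Real.sqrt_pos.2 hQ
  have hqh0 : 0 ≤ qh := Real.sqrt_nonneg _
  have hqq : q ^ 2 = Qhat n x y β₀ := Real.sq_sqrt (by rw [hQ0]; exact hQ.le)
  have hqqh : qh ^ 2 = Qhat n x y βh := Real.sq_sqrt hQh0
  have hSd : (En n fun i => dot (x i) δ * (σ * ε i + rr i)) = q * dot S δ := by
    rw [hS, score_dot, ← hQ0, ← hq]; field_simp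
  -- lower bound by convexity
  have hlow : q - dot S δ ≤ qh := by
    have h := (le_abs_self _).trans (En_cs_s10 n (fun i => σ * ε i + rr i)
      (fun i => y i - dot (x i) βh))
    have e1 : (En n fun i => (σ * ε i + rr i) * (y i - dot (x i) βh)) = q ^ 2 - q * dot S δ := by
      rw [hqq, hQ0, ← hSd, ← En_sub]
      congr 1; funext i; rw [hresh]; ring
    rw [e1, ← hQ0] at h
    change _ ≤ q * qh at h
    refine le_of_mul_le_mul_left ?_ hq0
    linarith
  -- optimality
  have hopt := hmin β₀
  have hopt1 : qh - q ≤ k * (l1 (scl γ β₀) - l1 (scl γ βh)) := by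
    rw [mul_sub]; linarith
  have hopt2 : qh - q ≤ k * (l1 (scl γ (restr T δ)) - l1 (scl γ (restr Tᶜ δ))) :=
    hopt1.trans (mul_le_mul_of_nonneg_left (l1_diff γ βh β₀) hk0.le)
  have hsd1 : dot S δ ≤ k / c * l1 (scl γ δ) :=
    (le_abs_self _).trans ((score_dot_l1 n x ε rr σ γ hγ δ).trans
      (mul_le_mul_of_nonneg_right hsup (l1_nonneg _)))
  have hkey : ∀ a b : ℝ, -(k / c * (a + b)) ≤ k * (a - b) → b ≤ cb * a := by
    intro a b h
    rw [hcb, div_mul_eq_mul_div, le_div_iff₀ hc1]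
    have : k * (c * (a - b) + (a + b)) = c * (k * (a - b) + k / c * (a + b)) := by
      field_simp
    have h2 : 0 ≤ k * (c * (a - b) + (a + b)) := by
      rw [this]; apply mul_nonneg hc0.le; linarith
    have h3 := nonneg_of_mul_nonneg_right h2 hk0
    linarith
  have hcone : l1 (scl γ (restr Tᶜ δ)) ≤ cb * l1 (scl γ (restr T δ)) := by
    apply hkey
    rw [← l1_split]; linarith
  have hball : l1 (scl γ (δ + β₀)) ≤ cb * l1 (scl γ β₀) := by
    have : δ + β₀ = βh := by rw [hδ]; simp
    rw [this]
    apply hkey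
    have h1 : k / c * l1 (scl γ δ) ≤ k / c * (l1 (scl γ β₀) + l1 (scl γ βh)) := by
      apply mul_le_mul_of_nonneg_left _ (by positivity)
      have := l1_tri γ βh β₀
      linarith
    linarith
  have hvar : dot S δ ≤ R * N := (le_abs_self _).trans
    (varrho_bdd n x γ T β₀ S cb (fun d => score_dot_le n x ε rr σ d hQ) δ hcone hball)
  -- upper bound
  have hρ0 : 0 ≤ ρ := by rw [hρdef]; positivity
  have hup : qh - q ≤ ρ * N := by
    refine hopt2.trans ((mul_le_mul_of_nonneg_left (kappa_ineq n x γ T hκ δ) hk0.le).trans ?_)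
    rw [hρdef, hk]; apply le_of_eq; field_simp; rfl
  have hexp : qh ^ 2 = q ^ 2 + N ^ 2 - 2 * (q * dot S δ) := by
    have e : Qhat n x y βh = En n fun i => ((σ * ε i + rr i) ^ 2 + dot (x i) δ ^ 2) -
        2 * (dot (x i) δ * (σ * ε i + rr i)) := by
      unfold Qhat; congr 1; funext i; rw [hresh]; ring
    rw [hqqh, hqq, e, En_sub, En_add, En_smul, hSd, hQ0]
    have : N ^ 2 = En n fun i => dot (x i) δ ^ 2 := Real.sq_sqrt (En_sq_nonneg _ _)
    rw [this]
  have h1ρ : 0 < 1 - ρ ^ 2 := by nlinarith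
  have hNle : N * (1 - ρ ^ 2) ≤ 2 * q * (R + ρ) := by
    have h1 : qh ^ 2 ≤ (q + ρ * N) ^ 2 := pow_le_pow_left₀ hqh0 (by linarith) 2
    have h2 : q * dot S δ ≤ q * (R * N) := mul_le_mul_of_nonneg_left hvar hq0.le
    rcases hN0.eq_or_lt with h | h
    · rw [← h]; simp; positivity
    · refine le_of_mul_le_mul_left ?_ h
      nlinarith
  set K := 2 * R * (R + ρ) / (1 - ρ ^ 2) with hK
  have hlow2 : q * (1 - K) ≤ qh := by
    have h1 : N ≤ 2 * q * (R + ρ) / (1 - ρ ^ 2) := by rwa [le_div_iff₀ h1ρ]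
    have h2 := mul_le_mul_of_nonneg_left h1 hR0
    have h3 : R * (2 * q * (R + ρ) / (1 - ρ ^ 2)) = q * K := by rw [hK]; ring
    linarith
  -- sparsity
  have hcomp : ∀ j ∈ supp βh, k * (qh - q / c) ≤
      |(En n fun i => x i j * dot (x i) δ) / γ j| := by
    intro j hj
    have hj' : βh j ≠ 0 := by simpa [supp] using hj
    have hg : 0 < γ j := lt_of_lt_of_le one_pos (hγ j)
    have h1 := kkt n x y γ βh hγ k hk0.le hmin j hj'
    have h2 := (score_le n x ε rr σ γ hγ j).trans (mul_le_mul_of_nonneg_right hsup hg.le)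
    have e1 : (En n fun i => x i j * (y i - dot (x i) βh)) =
        (En n fun i => x i j * (σ * ε i + rr i)) - En n fun i => x i j * dot (x i) δ := by
      rw [← En_sub]; congr 1; funext i; rw [hresh]; ring
    have e2 : (En n fun i => x i j * (σ * ε i + rr i)) = q * S j := by
      rw [hS]; unfold score; rw [← hQ0, ← hq]; field_simp
    rw [e1, e2] at h1
    have h3 := abs_sub (q * S j) (En n fun i => x i j * dot (x i) δ)
    rw [abs_mul, abs_of_pos hq0] at h3
    have h4 := mul_le_mul_of_nonneg_left h2 hq0.le
    rw [abs_div, abs_of_pos hg, le_div_iff₀ hg]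
    have e3 : k * (qh - q / c) * γ j = qh * k * γ j - q * (k / c * γ j) := by ring
    rw [e3]
    linarith
  have hsφ : 0 < Real.sqrt φ := Real.sqrt_pos.2 hφ
  have hsparse : k * (qh - q / c) * Real.sqrt (supp βh).card ≤ Real.sqrt φ * N := by
    rcases le_or_gt 0 (k * (qh - q / c)) with h | h
    · exact sparse_bound n x γ δ T (supp βh) hφ _ h hcomp
    · exact (mul_nonpos_of_nonpos_of_nonneg h.le (Real.sqrt_nonneg _)).trans (by positivity)
  have hfin : k * (q * (1 - 1 / c - K)) * Real.sqrt (supp βh).card ≤ Real.sqrt φ * N := by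
    refine le_trans ?_ hsparse
    apply mul_le_mul_of_nonneg_right _ (Real.sqrt_nonneg _)
    apply mul_le_mul_of_nonneg_left _ hk0.le
    have : q * (1 - 1 / c - K) = q * (1 - K) - q / c := by ring
    linarith
  have e : lam * Real.sqrt (supp βh).card * q / (n * Real.sqrt φ) * (1 - 1 / c - K) =
      k * (q * (1 - 1 / c - K)) * Real.sqrt (supp βh).card / Real.sqrt φ := by
    rw [hk]; field_simp
  rw [e, div_le_iff₀ hsφ]
  linarith
end SqrtLasso
end
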